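/- arXiv:1412.8416 — 2 statements merged into one kernel-verified Lean document; each statement's English description precedes it below -/
import Mathlib

section
/- Assume H ≠ 0 and strict feasibility, i.e., c/r^max + w/f_T < T̃. Then every global minimizer (Q★, f★) of the energy E(Q) = c·tr(Q)/r(Q) over X_s satisfies f★ = f_T and the latency constraint active with equality: c/r(Q★) + w/f_T = T̃. -/
open Matrix ComplexOrder

/-- Achievable rate `r(Q) = log₂ det(I + Hᴴ R_w⁻¹ H Q)`. -/
noncomputable def rate {nT nR : ℕ} (H : Matrix (Fin nR) (Fin nT) ℂ)
    (Rw : Matrix (Fin nR) (Fin nR) ℂ) (Q : Matrix (Fin nT) (Fin nT) ℂ) : ℝ :=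
  Real.logb 2 ((1 + Hᴴ * Rw⁻¹ * H * Q).det).re

/-- Energy `E(Q) = c · tr(Q) / r(Q)`. -/
noncomputable def energy {nT nR : ℕ} (H : Matrix (Fin nR) (Fin nT) ℂ)
    (Rw : Matrix (Fin nR) (Fin nR) ℂ) (c : ℝ) (Q : Matrix (Fin nT) (Fin nT) ℂ) : ℝ :=
  c * (Q.trace).re / rate H Rw Q

/-- Single-user feasible set `X_s`. -/
def Xs {nT nR : ℕ} (H : Matrix (Fin nR) (Fin nT) ℂ) (Rw : Matrix (Fin nR) (Fin nR) ℂ)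
    (c w fT PT Tt : ℝ) : Set (Matrix (Fin nT) (Fin nT) ℂ × ℝ) :=
  {p | p.1.PosSemidef ∧ (p.1.trace).re ≤ PT ∧ 0 < p.2 ∧ p.2 ≤ fT ∧
    0 < rate H Rw p.1 ∧ c / rate H Rw p.1 + w / p.2 ≤ Tt}

/-- Strict concavity of the logarithm along the segment from `1` to `1 + x`. -/
theorem mul_logb_one_add_lt {θ x : ℝ} (h0 : 0 < θ) (h1 : θ < 1) (hx : 0 < x) :
    θ * Real.logb 2 (1 + x) < Real.logb 2 (1 + θ * x) := by
  have h := strictConcaveOn_log_Ioi.2 (x := 1) (y := 1 + x) (by simp)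
    (by simp only [Set.mem_Ioi]; linarith) (by linarith) (sub_pos.2 h1) h0 (by ring)
  simp only [smul_eq_mul, Real.log_one, mul_zero, zero_add] at h
  rw [show (1 - θ) * 1 + θ * (1 + x) = 1 + θ * x by ring] at h
  rw [Real.logb, Real.logb, ← mul_div_assoc]
  exact div_lt_div_of_pos_right h (Real.log_pos (by norm_num))

theorem Matrix.IsHermitian.det_one_add_smul {n : Type*} [Fintype n] [DecidableEq n]
    {M : Matrix n n ℂ} (hM : M.IsHermitian) (θ : ℂ) :
    (1 + θ • M).det = ∏ i, (1 + θ * (hM.eigenvalues i : ℂ)) := by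
  set U : Matrix n n ℂ := ↑hM.eigenvectorUnitary
  set D : Matrix n n ℂ := diagonal (fun i => (hM.eigenvalues i : ℂ))
  have hU : U * star U = 1 := Unitary.coe_mul_star_self hM.eigenvectorUnitary
  have hspec : M = U * D * star U := by
    have h := hM.spectral_theorem
    rw [Unitary.conjStarAlgAut_apply] at h
    exact h
  have hfac : 1 + θ • M = U * (1 + θ • D) * star U := by
    rw [mul_add, add_mul, mul_one, hU, mul_smul_comm, smul_mul_assoc, ← hspec]
  have hdet : U.det * (star U).det = 1 := by rw [← det_mul, hU, det_one]
  have hdiag : 1 + θ • D = diagonal (fun i => 1 + θ * (hM.eigenvalues i : ℂ)) := by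
    rw [← diagonal_one, ← diagonal_smul, diagonal_add]
    rfl
  rw [hfac, det_mul, det_mul, mul_right_comm, hdet, one_mul, hdiag, det_diagonal]

open scoped MatrixOrder Matrix.Norms.L2Operator in
theorem Matrix.PosSemidef.exists_eq_conjTranspose_mul_self {n : Type*} [Fintype n] [DecidableEq n]
    {Q : Matrix n n ℂ} (hQ : Q.PosSemidef) : ∃ B : Matrix n n ℂ, Q = Bᴴ * B :=
  CStarAlgebra.nonneg_iff_eq_star_mul_self.mp hQ.nonneg

/-- Along the ray through `Q` the rate is a sum of scalar rates. -/
theorem exists_rate_smul_eq_sum {nT nR : ℕ} (H : Matrix (Fin nR) (Fin nT) ℂ)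
    {Rw : Matrix (Fin nR) (Fin nR) ℂ} (hRw : Rw.PosDef)
    {Q : Matrix (Fin nT) (Fin nT) ℂ} (hQ : Q.PosSemidef) :
    ∃ l : Fin nT → ℝ, (∀ i, 0 ≤ l i) ∧
      ∀ θ : ℝ, 0 ≤ θ → rate H Rw ((θ : ℂ) • Q) = ∑ i, Real.logb 2 (1 + θ * l i) := by
  obtain ⟨B, rfl⟩ := hQ.exists_eq_conjTranspose_mul_self
  have hM : (B * (Hᴴ * Rw⁻¹ * H) * Bᴴ).PosSemidef :=
    (hRw.inv.posSemidef.conjTranspose_mul_mul_same H).mul_mul_conjTranspose_same B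
  refine ⟨hM.isHermitian.eigenvalues, hM.eigenvalues_nonneg, fun θ hθ => ?_⟩
  have hdet : (1 + Hᴴ * Rw⁻¹ * H * ((θ : ℂ) • (Bᴴ * B))).det
      = ((∏ i, (1 + θ * hM.isHermitian.eigenvalues i) : ℝ) : ℂ) := by
    rw [mul_smul_comm, ← mul_assoc, ← smul_mul_assoc, det_one_add_mul_comm, mul_smul_comm,
      ← mul_assoc, hM.isHermitian.det_one_add_smul]
    push_cast
    rfl
  rw [rate, hdet, Complex.ofReal_re, Real.logb_prod]
  intro i _
  have := mul_nonneg hθ (hM.eigenvalues_nonneg i)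
  positivity

/-- A strictly feasible latency leaves room to scale `Q` down and lower the energy. -/
theorem exists_smul_energy_lt {nT nR : ℕ} (H : Matrix (Fin nR) (Fin nT) ℂ)
    {Rw : Matrix (Fin nR) (Fin nR) ℂ} (hRw : Rw.PosDef) {c a b : ℝ} (hc : 0 < c)
    {Q : Matrix (Fin nT) (Fin nT) ℂ} (hQ : Q.PosSemidef) (hr : 0 < rate H Rw Q)
    (hlat : c / rate H Rw Q + a < b) :
    ∃ Q' : Matrix (Fin nT) (Fin nT) ℂ, Q'.PosSemidef ∧ Q'.trace.re ≤ Q.trace.re ∧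
      0 < rate H Rw Q' ∧ c / rate H Rw Q' + a < b ∧ energy H Rw c Q' < energy H Rw c Q := by
  obtain ⟨l, hl, hrate⟩ := exists_rate_smul_eq_sum H hRw hQ
  have h1 : rate H Rw Q = ∑ i, Real.logb 2 (1 + l i) := by
    simpa using hrate 1 zero_le_one
  have htr : 0 < Q.trace.re := by
    have hnn := Complex.nonneg_iff.1 hQ.trace_nonneg
    refine hnn.1.lt_of_ne fun h => hr.ne' ?_
    have : Q = 0 := hQ.trace_eq_zero_iff.1 (Complex.ext h.symm hnn.2.symm)
    simp [rate, this]
  obtain ⟨j, hj⟩ : ∃ j, 0 < l j := by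
    by_contra! h
    have hz : ∀ i, l i = 0 := fun i => le_antisymm (h i) (hl i)
    simp [h1, hz] at hr
  have hcont : ContinuousAt (fun θ : ℝ => ∑ i, Real.logb 2 (1 + θ * l i)) 1 := by
    refine tendsto_finsetSum _ fun i _ => ?_
    have : (1 : ℝ) + 1 * l i ≠ 0 := by have := hl i; positivity
    have hlin : ContinuousAt (fun θ : ℝ => 1 + θ * l i) 1 := by fun_prop
    exact (hlin.log this).div_const (Real.log 2)
  have hval : (∑ i, Real.logb 2 (1 + 1 * l i)) = rate H Rw Q := by simp [h1]
  have hev1 := hcont.eventually_const_lt (u := 0) (by simpa only [hval] using hr)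
  have hev2 := ((continuousAt_const (y := c)).div hcont (by rw [hval]; exact hr.ne')).add
    (continuousAt_const (y := a)) |>.eventually_lt_const (u := b)
    (by simpa [h1] using hlat)
  have hev3 := eventually_gt_nhds (zero_lt_one (α := ℝ))
  obtain ⟨θ, ⟨⟨hθr, hθl⟩, hθ0⟩, hθ1⟩ :=
    (((hev1.and hev2).and hev3).filter_mono nhdsWithin_le_nhds |>.and
      (self_mem_nhdsWithin (a := (1 : ℝ)) (s := Set.Iio 1))).exists
  replace hθ1 : θ < 1 := hθ1
  have hrθ := hrate θ hθ0.le
  have hlt : θ * rate H Rw Q < rate H Rw ((θ : ℂ) • Q) := by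
    rw [h1, hrθ, Finset.mul_sum]
    refine Finset.sum_lt_sum (fun i _ => ?_)
      ⟨j, Finset.mem_univ j, mul_logb_one_add_lt hθ0 hθ1 hj⟩
    rcases (hl i).eq_or_lt with h | h
    · simp [← h]
    · exact (mul_logb_one_add_lt hθ0 hθ1 h).le
  have htrθ : ((θ : ℂ) • Q).trace.re = θ * Q.trace.re := by simp [trace_smul]
  have hposθ : 0 < rate H Rw ((θ : ℂ) • Q) := by rw [hrθ]; exact hθr
  refine ⟨(θ : ℂ) • Q, hQ.smul (by exact_mod_cast hθ0.le), ?_, hposθ, ?_, ?_⟩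
  · rw [htrθ]; nlinarith
  · rw [hrθ]; exact hθl
  · rw [energy, energy, htrθ, div_lt_div_iff₀ hposθ hr]
    calc c * (θ * Q.trace.re) * rate H Rw Q = c * Q.trace.re * (θ * rate H Rw Q) := by ring
      _ < _ := mul_lt_mul_of_pos_left hlt (mul_pos hc htr)

/-- Under `H ≠ 0` and strict feasibility, every global minimizer `(Q⋆, f⋆)` of the
energy over `X_s` uses the full computational budget, `f⋆ = f_T`, and has active
latency constraint: `c/r(Q⋆) + w/f_T = T̃`. -/
theorem energy_min_full_budget_active_latency {nT nR : ℕ}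
    (H : Matrix (Fin nR) (Fin nT) ℂ) (Rw : Matrix (Fin nR) (Fin nR) ℂ) (hRw : Rw.PosDef)
    (c w fT PT Tt rmax : ℝ) (hc : 0 < c) (hw : 0 < w) (hfT : 0 < fT) (hPT : 0 < PT)
    (hH : H ≠ 0)
    (hrmax : IsGreatest (rate H Rw '' {Q | Q.PosSemidef ∧ (Q.trace).re ≤ PT}) rmax)
    (hstrict : c / rmax + w / fT < Tt)
    (Qstar : Matrix (Fin nT) (Fin nT) ℂ) (fstar : ℝ)
    (hfeas : (Qstar, fstar) ∈ Xs H Rw c w fT PT Tt)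
    (hmin : ∀ p ∈ Xs H Rw c w fT PT Tt, energy H Rw c Qstar ≤ energy H Rw c p.1) :
    fstar = fT ∧ c / rate H Rw Qstar + w / fT = Tt := by
  obtain ⟨hQ, htr, hf0, hf, hr, hlat⟩ := hfeas
  simp only at hQ htr hf0 hf hr hlat
  have hle : w / fT ≤ w / fstar := div_le_div_of_nonneg_left hw.le hf0 hf
  have hge : Tt ≤ c / rate H Rw Qstar + w / fT := by
    by_contra! hlt
    obtain ⟨Q', hQ', htr', hr', hlat', hen⟩ := exists_smul_energy_lt H hRw hc hQ hr hlt
    exact (hmin (Q', fT) ⟨hQ', htr'.trans htr, hfT, le_rfl, hr', hlat'.le⟩).not_gt hen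
  refine ⟨hf.antisymm (not_lt.1 fun hlt => ?_), by linarith⟩
  have := div_lt_div_of_pos_left hw hf0 hlt
  linarith
end

section
/- Suppose (Q̄, f̄) ∈ X_s satisfies the first-order stationarity (variational inequality) condition: Re tr( G(Q̄)·(Q − Q̄) ) ≥ 0 for every (Q, f) ∈ X_s, where G(Q̄) := (c/r(Q̄)²)·( r(Q̄)·I_{n_T} − (tr(Q̄)/ln 2)·Hᴴ (R_w + H Q̄ Hᴴ)⁻¹ H ). Then (Q̄, f̄) is a global minimizer of E over X_s: E(Q̄) ≤ E(Q) for all (Q, f) ∈ X_s. (Every stationary point of the nonconvex energy-minimization problem P_s is a global optimal solution.) -/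
open Matrix ComplexOrder

/-- Conjugate gradient of the energy. -/
noncomputable def gradE {nT nR : ℕ} (H : Matrix (Fin nR) (Fin nT) ℂ)
    (Rw : Matrix (Fin nR) (Fin nR) ℂ) (c : ℝ) (Y : Matrix (Fin nT) (Fin nT) ℂ) :
    Matrix (Fin nT) (Fin nT) ℂ :=
  (c / (rate H Rw Y) ^ 2) •
    (rate H Rw Y • (1 : Matrix (Fin nT) (Fin nT) ℂ)
      - ((Y.trace).re / Real.log 2) • (Hᴴ * (Rw + H * Y * Hᴴ)⁻¹ * H))

theorem Matrix.PosDef.log_det_re_le {n : Type*} [Fintype n] [DecidableEq n] {C : Matrix n n ℂ}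
    (hC : C.PosDef) :
    Real.log C.det.re ≤ C.trace.re - Fintype.card n := by
  have hdet : C.det.re = ∏ i, hC.isHermitian.eigenvalues i := by
    rw [hC.isHermitian.det_eq_prod_eigenvalues]
    exact_mod_cast Complex.ofReal_re _
  have htr : C.trace.re = ∑ i, hC.isHermitian.eigenvalues i := by
    rw [hC.isHermitian.trace_eq_sum_eigenvalues]
    exact_mod_cast Complex.ofReal_re _
  rw [hdet, htr, Real.log_prod fun i _ => (hC.eigenvalues_pos i).ne']
  calc ∑ i, Real.log (hC.isHermitian.eigenvalues i)
      ≤ ∑ i, (hC.isHermitian.eigenvalues i - 1) :=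
        Finset.sum_le_sum fun i _ => Real.log_le_sub_one_of_pos (hC.eigenvalues_pos i)
    _ = _ := by simp

open scoped MatrixOrder in
theorem Matrix.PosDef.log_det_re_concave {n : Type*} [Fintype n] [DecidableEq n] {A B : Matrix n n ℂ}
    (hA : A.PosDef) (hB : B.PosDef) :
    Real.log B.det.re ≤ Real.log A.det.re + (A⁻¹ * (B - A)).trace.re := by
  obtain ⟨M, hM⟩ : ∃ M : Matrix n n ℂ, A⁻¹ = Mᴴ * M :=
    CStarAlgebra.nonneg_iff_eq_star_mul_self.mp hA.inv.posSemidef.nonneg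
  have hAdet : A.det ≠ 0 := hA.det_pos.ne'
  have hAunit : IsUnit A.det := isUnit_iff_ne_zero.mpr hAdet
  have hMA : Mᴴ * M * A = 1 := by rw [← hM, nonsing_inv_mul _ hAunit]
  have hMdet : M.det ≠ 0 := by
    intro h
    have := congrArg Matrix.det hMA
    simp [h] at this
  have hMunit : IsUnit M := (isUnit_iff_isUnit_det M).mpr (isUnit_iff_ne_zero.mpr hMdet)
  have hC : (M * B * Mᴴ).PosDef := by
    have hinj : Function.Injective M.vecMul := vecMul_injective_of_isUnit hMunit
    exact hB.mul_mul_conjTranspose_same hinj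
  have htr : (A⁻¹ * (B - A)).trace = (M * B * Mᴴ).trace - Fintype.card n := by
    rw [mul_sub, nonsing_inv_mul _ hAunit, trace_sub, trace_one, hM,
      trace_mul_comm (M * B), ← mul_assoc]
  have hdet : B.det = A.det * (M * B * Mᴴ).det := by
    have h := congrArg Matrix.det hMA
    simp only [det_mul, det_one] at h ⊢
    linear_combination -B.det * h
  have hApos := Complex.pos_iff.mp hA.det_pos
  have hCpos := Complex.pos_iff.mp hC.det_pos
  have hre : B.det.re = A.det.re * (M * B * Mᴴ).det.re := by
    rw [hdet, Complex.mul_re, ← hApos.2]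
    simp
  rw [hre, Real.log_mul hApos.1.ne' hCpos.1.ne', htr]
  have := hC.log_det_re_le
  simp only [Complex.sub_re, Complex.natCast_re]
  linarith

theorem posDef_add_mul_mul_conjTranspose {nT nR : ℕ} (H : Matrix (Fin nR) (Fin nT) ℂ)
    {Rw : Matrix (Fin nR) (Fin nR) ℂ} (hRw : Rw.PosDef)
    {Q : Matrix (Fin nT) (Fin nT) ℂ} (hQ : Q.PosSemidef) : (Rw + H * Q * Hᴴ).PosDef :=
  hRw.add_posSemidef (hQ.mul_mul_conjTranspose_same H)

theorem rate_eq_log_sub_log {nT nR : ℕ} (H : Matrix (Fin nR) (Fin nT) ℂ)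
    {Rw : Matrix (Fin nR) (Fin nR) ℂ} (hRw : Rw.PosDef)
    {Q : Matrix (Fin nT) (Fin nT) ℂ} (hQ : Q.PosSemidef) :
    rate H Rw Q = (Real.log (Rw + H * Q * Hᴴ).det.re - Real.log Rw.det.re) / Real.log 2 := by
  have hR := Complex.pos_iff.mp hRw.det_pos
  have hB := Complex.pos_iff.mp (posDef_add_mul_mul_conjTranspose H hRw hQ).det_pos
  have hunit : IsUnit Rw.det := isUnit_iff_ne_zero.mpr hRw.det_pos.ne'
  have hdet : (Rw + H * Q * Hᴴ).det = Rw.det * (1 + Hᴴ * Rw⁻¹ * H * Q).det := by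
    rw [show Hᴴ * Rw⁻¹ * H * Q = Hᴴ * (Rw⁻¹ * H * Q) by simp only [Matrix.mul_assoc],
      det_one_add_mul_comm, ← det_mul, mul_add, mul_one, Matrix.mul_assoc Rw⁻¹ H Q,
      Matrix.mul_assoc Rw⁻¹, ← Matrix.mul_assoc Rw,
      mul_nonsing_inv _ hunit, Matrix.one_mul]
  have hre : (Rw + H * Q * Hᴴ).det.re = Rw.det.re * (1 + Hᴴ * Rw⁻¹ * H * Q).det.re := by
    rw [hdet, Complex.mul_re, ← hR.2]
    simp
  have hne : (1 + Hᴴ * Rw⁻¹ * H * Q).det.re ≠ 0 := by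
    intro h
    rw [h, mul_zero] at hre
    exact hB.1.ne' hre
  rw [hre, Real.log_mul hR.1.ne' hne, add_sub_cancel_left]
  rfl

theorem rate_concave {nT nR : ℕ} (H : Matrix (Fin nR) (Fin nT) ℂ)
    {Rw : Matrix (Fin nR) (Fin nR) ℂ} (hRw : Rw.PosDef)
    {Q Y : Matrix (Fin nT) (Fin nT) ℂ} (hQ : Q.PosSemidef) (hY : Y.PosSemidef) :
    rate H Rw Q ≤ rate H Rw Y +
      (Hᴴ * (Rw + H * Y * Hᴴ)⁻¹ * H * (Q - Y)).trace.re / Real.log 2 := by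
  have htr : (Hᴴ * (Rw + H * Y * Hᴴ)⁻¹ * H * (Q - Y)).trace =
      ((Rw + H * Y * Hᴴ)⁻¹ * ((Rw + H * Q * Hᴴ) - (Rw + H * Y * Hᴴ))).trace := by
    rw [add_sub_add_left_eq_sub, ← Matrix.sub_mul, ← Matrix.mul_sub, Matrix.mul_assoc,
      Matrix.mul_assoc, trace_mul_comm]
    simp only [Matrix.mul_assoc]
  have h := (posDef_add_mul_mul_conjTranspose H hRw hY).log_det_re_concave
    (posDef_add_mul_mul_conjTranspose H hRw hQ)
  rw [rate_eq_log_sub_log H hRw hQ, rate_eq_log_sub_log H hRw hY, htr, ← add_div]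
  have := Real.log_pos one_lt_two
  gcongr
  linarith

theorem trace_gradE_mul_re {nT nR : ℕ} (H : Matrix (Fin nR) (Fin nT) ℂ)
    (Rw : Matrix (Fin nR) (Fin nR) ℂ) (c : ℝ) (Y Q : Matrix (Fin nT) (Fin nT) ℂ) :
    (gradE H Rw c Y * (Q - Y)).trace.re = c / rate H Rw Y ^ 2 *
      (rate H Rw Y * (Q.trace.re - Y.trace.re) -
        Y.trace.re * ((Hᴴ * (Rw + H * Y * Hᴴ)⁻¹ * H * (Q - Y)).trace.re / Real.log 2)) := by
  rw [gradE, smul_mul_assoc, sub_mul, smul_mul_assoc, smul_mul_assoc, one_mul, trace_smul,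
    trace_sub, trace_smul, trace_smul, Complex.smul_re, Complex.sub_re, Complex.smul_re,
    Complex.smul_re, trace_sub, Complex.sub_re]
  simp only [smul_eq_mul]
  ring

/-- Every stationary point of the nonconvex energy-minimization problem `P_s`
(in the variational-inequality sense) is a global minimizer of `E` over `X_s`. -/
theorem stationary_implies_global_min {nT nR : ℕ}
    (H : Matrix (Fin nR) (Fin nT) ℂ) (Rw : Matrix (Fin nR) (Fin nR) ℂ) (hRw : Rw.PosDef)
    (c w fT PT Tt : ℝ) (hc : 0 < c) (hw : 0 < w) (hfT : 0 < fT) (hPT : 0 < PT)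
    (Qbar : Matrix (Fin nT) (Fin nT) ℂ) (fbar : ℝ)
    (hfeas : (Qbar, fbar) ∈ Xs H Rw c w fT PT Tt)
    (hstat : ∀ p ∈ Xs H Rw c w fT PT Tt,
      0 ≤ (((gradE H Rw c Qbar) * (p.1 - Qbar)).trace).re) :
    ∀ p ∈ Xs H Rw c w fT PT Tt, energy H Rw c Qbar ≤ energy H Rw c p.1 := by
  rintro ⟨Q, f⟩ hp
  have hgrad := hstat _ hp
  obtain ⟨hQ, -, -, -, hr, -⟩ := hp
  obtain ⟨hY, -, -, -, hrbar, -⟩ := hfeas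
  dsimp only at hQ hr hY hrbar hgrad ⊢
  rw [trace_gradE_mul_re] at hgrad
  have hlin := nonneg_of_mul_nonneg_right hgrad (div_pos hc (pow_pos hrbar 2))
  have htr : 0 ≤ Qbar.trace.re := (Complex.nonneg_iff.mp hY.trace_nonneg).1
  have hrate := mul_le_mul_of_nonneg_left (rate_concave H hRw hQ hY) htr
  rw [energy, energy, div_le_div_iff₀ hrbar hr, mul_assoc, mul_assoc]
  refine mul_le_mul_of_nonneg_left ?_ hc.le
  linarith
end
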